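/- arXiv:2301.01708 — 2 statements merged into one kernel-verified Lean document; each statement's English description precedes it below -/
import Mathlib

section
/- Let T be a tree on n vertices with diameter 3. Then ξ_1(T^c) ≥ sqrt((4n+1+sqrt(72n−63))/2) if n is even, and ξ_1(T^c) ≥ sqrt((4n+1+sqrt(72n−47))/2) if n is odd; in either case equality holds if and only if T is isomorphic to T_{n,3}^{⌊(n−4)/2⌋,⌈(n−4)/2⌉}. -/
noncomputable section

open SimpleGraph

/-- The eccentricity of a vertex: the maximum distance to the other vertices. -/
def ecc {n : ℕ} (G : SimpleGraph (Fin n)) (v : Fin n) : ℕ :=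
  Finset.univ.sup fun u => G.dist v u

/-- The eccentricity matrix of a graph on `Fin n`: the `(u,v)` entry is
`d(u,v)` if `u ≠ v` and `d(u,v) = min (ecc u) (ecc v)`, and `0` otherwise. -/
def eccMatrix {n : ℕ} (G : SimpleGraph (Fin n)) : Matrix (Fin n) (Fin n) ℝ :=
  fun u v =>
    if u ≠ v ∧ G.dist u v = min (ecc G u) (ecc G v) then (G.dist u v : ℝ) else 0

/-- The multiset of eigenvalues of the eccentricity matrix (the roots of its
characteristic polynomial, with multiplicity). -/
def eccEigs {n : ℕ} (G : SimpleGraph (Fin n)) : Multiset ℝ :=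
  ((eccMatrix G).charpoly).roots

/-- The eigenvalues of the eccentricity matrix, listed in non-increasing order. -/
def eccEigList {n : ℕ} (G : SimpleGraph (Fin n)) : List ℝ :=
  ((eccEigs G).sort (· ≤ ·)).reverse

/-- `xi G k` is the `k`-th largest eigenvalue of the eccentricity matrix of `G`
(1-indexed, so `xi G 1` is the `𝓔`-spectral radius and `xi G n` is the least
`𝓔`-eigenvalue). -/
def xi {n : ℕ} (G : SimpleGraph (Fin n)) (k : ℕ) : ℝ :=
  (eccEigList G).getD (k - 1) 0

/-- The eccentricity energy of `G`: the sum of the absolute values of the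
eigenvalues of the eccentricity matrix. -/
def eccEnergy {n : ℕ} (G : SimpleGraph (Fin n)) : ℝ :=
  ((eccEigs G).map fun x => |x|).sum

/-- The star `K_{1,n-1}` on `Fin n`, centered at `0`. -/
def starGraph (n : ℕ) : SimpleGraph (Fin n) :=
  SimpleGraph.fromRel fun u _ => u.val = 0

/-- The diameter of a graph on `Fin n`. -/
def gdiam {n : ℕ} (G : SimpleGraph (Fin n)) : ℕ :=
  Finset.univ.sup fun p : Fin n × Fin n => G.dist p.1 p.2

/-- The tree `T_{n,d}^{a,b}` (with `b = n - d - 1 - a`): a path `v₀v₁⋯v_d` with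
`a` pendant vertices attached to `v₁` and the remaining `n - d - 1 - a` pendant
vertices attached to `v_{d-1}`.  Vertices `0,…,d` form the path, vertices
`d+1,…,d+a` are the pendants at `v₁`, and vertices `d+a+1,…,n-1` are the
pendants at `v_{d-1}`. -/
def Tnd (n d a : ℕ) : SimpleGraph (Fin n) :=
  SimpleGraph.fromRel fun u v =>
    (u.val + 1 = v.val ∧ v.val ≤ d) ∨
    (u.val = 1 ∧ d < v.val ∧ v.val ≤ d + a) ∨
    (u.val = d - 1 ∧ d + a < v.val)

def mAdj {α β : Type} : Bool ⊕ (α ⊕ β) → Bool ⊕ (α ⊕ β) → Prop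
  | .inl a, .inl b => a ≠ b
  | .inl a, .inr (.inl _) => a = false
  | .inr (.inl _), .inl a => a = false
  | .inl a, .inr (.inr _) => a = true
  | .inr (.inr _), .inl a => a = true
  | .inr _, .inr _ => False

def MG (α β : Type) : SimpleGraph (Bool ⊕ (α ⊕ β)) where
  Adj := mAdj
  symm := ⟨by
    rintro (a | a | a) (b | b | b) <;> simp [mAdj] <;> tauto⟩
  loopless := ⟨by
    rintro (a | a | a) <;> simp [mAdj]⟩

open Classical in
def mD {α β : Type} : Bool ⊕ (α ⊕ β) → Bool ⊕ (α ⊕ β) → ℕ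
  | .inl a, .inl b => if a = b then 0 else 3
  | .inl a, .inr (.inl _) => if a = false then 2 else 1
  | .inr (.inl _), .inl a => if a = false then 2 else 1
  | .inl a, .inr (.inr _) => if a = true then 2 else 1
  | .inr (.inr _), .inl a => if a = true then 2 else 1
  | .inr x, .inr y => if x = y then 0 else 1

def mW {α β : Type} : Matrix (Bool ⊕ (α ⊕ β)) (Bool ⊕ (α ⊕ β)) ℝ
  | .inl a, .inl b => if a = b then 0 else 3
  | .inl a, .inr (.inl _) => if a = false then 2 else 0
  | .inr (.inl _), .inl a => if a = false then 2 else 0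
  | .inl a, .inr (.inr _) => if a = true then 2 else 0
  | .inr (.inr _), .inl a => if a = true then 2 else 0
  | .inr _, .inr _ => 0

lemma my_dist2 {V : Type} {G : SimpleGraph V} {x w y : V} (h1 : G.Adj x w) (h2 : G.Adj w y)
    (hne : x ≠ y) (hn : ¬ G.Adj x y) : G.dist x y = 2 := by
  have h := dist_le (Walk.cons h1 (Walk.cons h2 Walk.nil))
  simp at h
  have h' := (h1.reachable.trans h2.reachable).one_lt_dist_of_ne_of_not_adj hne hn
  omega

lemma my_dist3 {V : Type} {G : SimpleGraph V} {x a b y : V} (h1 : G.Adj x a) (h2 : G.Adj a b)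
    (h3 : G.Adj b y)
    (hne : x ≠ y) (hn : ¬ G.Adj x y) (hc : ∀ w, G.Adj x w → ¬ G.Adj w y) : G.dist x y = 3 := by
  have h := dist_le (Walk.cons h1 (Walk.cons h2 (Walk.cons h3 Walk.nil)))
  simp at h
  have hr := (h1.reachable.trans h2.reachable).trans h3.reachable
  have h' := hr.one_lt_dist_of_ne_of_not_adj hne hn
  have h2 : G.dist x y ≠ 2 := by
    intro h2
    obtain ⟨p, hp⟩ := hr.exists_walk_length_eq_dist
    rw [h2] at hp
    match p, hp with
    | .cons ha (.cons hb .nil), _ => exact hc _ ha hb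
  omega

lemma compl_dist {V α β : Type} (T : SimpleGraph V) (e : T ≃g MG α β) (a0 : α) (b0 : β)
    (x y : V) : Tᶜ.dist x y = mD (e x) (e y) := by
  have hadj : ∀ z z' : Bool ⊕ (α ⊕ β), Tᶜ.Adj (e.symm z) (e.symm z') ↔ z ≠ z' ∧ ¬ mAdj z z' := by
    intro z z'
    rw [SimpleGraph.compl_adj, e.symm.map_adj_iff, e.symm.injective.ne_iff]
    rfl
  obtain ⟨z, rfl⟩ := e.symm.surjective x
  obtain ⟨z', rfl⟩ := e.symm.surjective y
  rw [e.apply_symm_apply, e.apply_symm_apply]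
  have hne : ∀ z z' : Bool ⊕ (α ⊕ β), z ≠ z' → e.symm z ≠ e.symm z' :=
    fun _ _ h h' => h (e.symm.injective h')
  have d1 : ∀ z z' : Bool ⊕ (α ⊕ β), z ≠ z' → ¬ mAdj z z' → Tᶜ.dist (e.symm z) (e.symm z') = 1 := by
    intro z z' h h'
    rw [dist_eq_one_iff_adj, hadj]
    exact ⟨h, h'⟩
  have dd2 : ∀ z w z' : Bool ⊕ (α ⊕ β), z ≠ z' → mAdj z z' → (z ≠ w ∧ ¬ mAdj z w) →
      (w ≠ z' ∧ ¬ mAdj w z') → Tᶜ.dist (e.symm z) (e.symm z') = 2 := by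
    intro z w z' h h' h1 h2
    refine my_dist2 ((hadj z w).2 h1) ((hadj w z').2 h2) (hne _ _ h) ?_
    rw [hadj]; tauto
  have dd3 : ∀ z a b z' : Bool ⊕ (α ⊕ β), z ≠ z' → mAdj z z' → (z ≠ a ∧ ¬ mAdj z a) →
      (a ≠ b ∧ ¬ mAdj a b) →
      (b ≠ z' ∧ ¬ mAdj b z') → (∀ w, (z ≠ w ∧ ¬ mAdj z w) → ¬ (w ≠ z' ∧ ¬ mAdj w z')) →
      Tᶜ.dist (e.symm z) (e.symm z') = 3 := by
    intro z a b z' h h' h1 h2 h3 h4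
    refine my_dist3 ((hadj z a).2 h1) ((hadj a b).2 h2) ((hadj b z').2 h3) (hne _ _ h) ?_ ?_
    · rw [hadj]; tauto
    · intro w
      obtain ⟨w, rfl⟩ := e.symm.surjective w
      rw [hadj, hadj]
      exact h4 w
  rcases z with (_ | _) | a | b <;> rcases z' with (_ | _) | a' | b'
  · simp [mD]
  · rw [dd3 _ (.inr (.inr b0)) (.inr (.inl a0))] <;> simp [mD, mAdj]
  · rw [dd2 _ (.inr (.inr b0))] <;> simp [mD, mAdj]
  · rw [d1] <;> simp [mD, mAdj]
  · rw [dd3 _ (.inr (.inl a0)) (.inr (.inr b0))] <;> simp [mD, mAdj]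
  · simp [mD]
  · rw [d1] <;> simp [mD, mAdj]
  · rw [dd2 _ (.inr (.inl a0))] <;> simp [mD, mAdj]
  · rw [dd2 _ (.inr (.inr b0))] <;> simp [mD, mAdj]
  · rw [d1] <;> simp [mD, mAdj]
  · by_cases h : a = a'
    · subst h; simp [mD]
    · rw [d1] <;> simp [mD, mAdj, h]
  · rw [d1] <;> simp [mD, mAdj]
  · rw [d1] <;> simp [mD, mAdj]
  · rw [dd2 _ (.inr (.inl a0))] <;> simp [mD, mAdj]
  · rw [d1] <;> simp [mD, mAdj]
  · by_cases h : b = b'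
    · subst h; simp [mD]
    · rw [d1] <;> simp [mD, mAdj, h]

def mE {α β : Type} : Bool ⊕ (α ⊕ β) → ℕ
  | .inl _ => 3
  | .inr _ => 2

lemma compl_ecc {n : ℕ} {α β : Type} (T : SimpleGraph (Fin n)) (e : T ≃g MG α β) (a0 : α) (b0 : β)
    (x : Fin n) : ecc Tᶜ x = mE (e x) := by
  unfold ecc
  simp only [compl_dist T e a0 b0]
  generalize e x = z
  apply le_antisymm
  · apply Finset.sup_le
    intro y _
    generalize e y = z'
    rcases z with (_ | _) | a | b <;> rcases z' with (_ | _) | a' | b' <;> simp [mD, mE] <;>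
      split_ifs <;> simp
  · have key : ∀ z', mD z z' ≤ Finset.univ.sup fun u => mD z (e u) := by
      intro z'
      have := Finset.le_sup (f := fun u => mD z (e u)) (Finset.mem_univ (e.symm z'))
      simpa using this
    rcases z with (_ | _) | a | b
    · exact le_trans (by simp [mD, mE]) (key (.inl true))
    · exact le_trans (by simp [mD, mE]) (key (.inl false))
    · exact le_trans (by simp [mD, mE]) (key (.inl false))
    · exact le_trans (by simp [mD, mE]) (key (.inl true))

lemma compl_mat {n : ℕ} {α β : Type} (T : SimpleGraph (Fin n)) (e : T ≃g MG α β) (a0 : α) (b0 : β)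
    (x y : Fin n) : eccMatrix Tᶜ x y = mW (e x) (e y) := by
  unfold eccMatrix
  rw [compl_ecc T e a0 b0, compl_ecc T e a0 b0, compl_dist T e a0 b0]
  have hxy : (x = y) = (e x = e y) := propext e.injective.eq_iff.symm
  generalize e x = z at hxy ⊢
  generalize e y = z' at hxy ⊢
  rcases z with (_ | _) | a | b <;> rcases z' with (_ | _) | a' | b' <;>
    simp [mD, mE, mW, hxy] <;> split_ifs <;> first | (simp; done) | (exfalso; omega)

lemma xi_eq {n : ℕ} (G : SimpleGraph (Fin n)) (μ : ℝ) (h1 : μ ∈ (eccMatrix G).charpoly.roots)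
    (h2 : ∀ r ∈ (eccMatrix G).charpoly.roots, r ≤ μ) : xi G 1 = μ := by
  have hmem : ∀ r, r ∈ eccEigList G ↔ r ∈ (eccMatrix G).charpoly.roots := by
    intro r; simp only [eccEigList, eccEigs, List.mem_reverse, Multiset.mem_sort]
  have hs : (eccEigList G).Pairwise (fun a b => b ≤ a) := by
    unfold eccEigList
    rw [List.pairwise_reverse]
    exact Multiset.pairwise_sort _ _
  unfold xi
  have h1' := (hmem μ).2 h1
  have h2' : ∀ r ∈ eccEigList G, r ≤ μ := fun r hr => h2 r ((hmem r).1 hr)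
  generalize eccEigList G = L at *
  cases L with
  | nil => simp at h1'
  | cons a l =>
    simp only [Nat.sub_self, List.getD_cons_zero]
    apply le_antisymm
    · exact h2' a (by simp)
    · rw [List.pairwise_cons] at hs
      rcases List.mem_cons.1 h1' with h | h
      · exact h.le
      · exact hs.1 _ h

lemma root_iff {ι : Type} [Fintype ι] [DecidableEq ι] (A : Matrix ι ι ℝ) (r : ℝ) :
    r ∈ A.charpoly.roots ↔ ∃ v, v ≠ 0 ∧ A.mulVec v = r • v := by
  rw [Polynomial.mem_roots (Matrix.charpoly_monic A).ne_zero, Polynomial.IsRoot.def,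
    Matrix.eval_charpoly, ← Matrix.exists_mulVec_eq_zero_iff]
  refine exists_congr fun v => and_congr_right fun _ => ?_
  rw [Matrix.sub_mulVec, sub_eq_zero, eq_comm]
  simp [Matrix.scalar_apply]

lemma mW_mulVec {α β : Type} [Fintype α] [Fintype β] (v : Bool ⊕ (α ⊕ β) → ℝ) (r : ℝ) :
    mW.mulVec v = r • v ↔
      (3 * v (.inl true) + 2 * ∑ a, v (.inr (.inl a)) = r * v (.inl false)) ∧
      (3 * v (.inl false) + 2 * ∑ b, v (.inr (.inr b)) = r * v (.inl true)) ∧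
      (∀ a, 2 * v (.inl false) = r * v (.inr (.inl a))) ∧
      (∀ b, 2 * v (.inl true) = r * v (.inr (.inr b))) := by
  rw [funext_iff]
  simp [Matrix.mulVec, dotProduct, mW, Finset.mul_sum]
  tauto

def RR (n p q : ℕ) : ℝ :=
  Real.sqrt ((4 * (n : ℝ) + 1 + Real.sqrt ((4 * (n : ℝ) + 1) ^ 2 - 64 * (p * q))) / 2)

lemma compl_xi {n : ℕ} {α β : Type} [Fintype α] [Fintype β]
    (T : SimpleGraph (Fin n)) (e : T ≃g MG α β)
    (ha : 0 < Fintype.card α) (hb : 0 < Fintype.card β) :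
    Fintype.card α + Fintype.card β + 2 = n ∧
    xi Tᶜ 1 = RR n (Fintype.card α) (Fintype.card β) := by
  classical
  obtain ⟨a0⟩ := Fintype.card_pos_iff.1 ha
  obtain ⟨b0⟩ := Fintype.card_pos_iff.1 hb
  have hn : Fintype.card α + Fintype.card β + 2 = n := by
    have := Fintype.card_congr e.toEquiv
    simp at this
    omega
  refine ⟨hn, ?_⟩
  have hmat : (eccMatrix Tᶜ).charpoly = (mW : Matrix (Bool ⊕ (α ⊕ β)) _ ℝ).charpoly := by
    rw [← Matrix.charpoly_reindex e.toEquiv (eccMatrix Tᶜ)]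
    congr 1
    ext z z'
    rw [Matrix.reindex_apply, Matrix.submatrix_apply, compl_mat T e a0 b0]
    congr 1
    · exact e.apply_symm_apply z
    · exact e.apply_symm_apply z'
  unfold RR
  generalize hp : Fintype.card α = p at *
  generalize hq : Fintype.card β = q at *
  have hn' : (p : ℝ) + q + 2 = n := by exact_mod_cast hn
  have hp1 : (1 : ℝ) ≤ p := by exact_mod_cast ha
  have hq1 : (1 : ℝ) ≤ q := by exact_mod_cast hb
  set D : ℝ := (4 * (n : ℝ) + 1) ^ 2 - 64 * (p * q) with hD
  have hD0 : 0 ≤ D := by rw [hD, ← hn']; nlinarith [sq_nonneg ((p : ℝ) - q)]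
  set s : ℝ := (4 * (n : ℝ) + 1 + Real.sqrt D) / 2 with hs
  have hsq := Real.sq_sqrt hD0
  have hs0 : 0 < s := by have := Real.sqrt_nonneg D; rw [hs]; linarith
  have hquad : (s - 4 * p) * (s - 4 * q) = 9 * s := by
    have : s ^ 2 - (4 * n + 1) * s + 16 * (p * q) = 0 := by
      rw [hs]; nlinarith
    rw [← hn'] at this
    linarith
  set l := Real.sqrt s with hl
  have hl0 : 0 < l := Real.sqrt_pos.2 hs0
  have hl2 : l ^ 2 = s := Real.sq_sqrt hs0.le
  apply xi_eq
  · rw [hmat, root_iff]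
    refine ⟨fun z => match z with
      | .inl false => 3 * l ^ 2
      | .inl true => l * (l ^ 2 - 4 * p)
      | .inr (.inl _) => 6 * l
      | .inr (.inr _) => 2 * (l ^ 2 - 4 * p), ?_, ?_⟩
    · intro h
      have := congrFun h (.inl false)
      simp at this
      exact hl0.ne' this
    · rw [mW_mulVec]
      simp only [Finset.sum_const, Finset.card_univ, hp, hq, nsmul_eq_mul]
      refine ⟨by ring, ?_, fun _ => by ring, fun _ => by ring⟩
      rw [← hl2] at hquad
      linear_combination -hquad
  · intro r hr
    rw [hmat, root_iff] at hr
    obtain ⟨v, hv, h⟩ := hr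
    rw [mW_mulVec] at h
    obtain ⟨h1, h2, h3, h4⟩ := h
    by_contra hlt
    push Not at hlt
    have hr0 : 0 < r := hl0.trans hlt
    have hsa : r * ∑ a, v (.inr (.inl a)) = p * (2 * v (.inl false)) := by
      rw [Finset.mul_sum, Finset.sum_congr rfl (fun a _ => (h3 a).symm)]
      simp [hp]
    have hsb : r * ∑ b, v (.inr (.inr b)) = q * (2 * v (.inl true)) := by
      rw [Finset.mul_sum, Finset.sum_congr rfl (fun a _ => (h4 a).symm)]
      simp [hq]
    have e1 : 3 * r * v (.inl true) = (r ^ 2 - 4 * p) * v (.inl false) := by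
      linear_combination r * h1 - 2 * hsa
    have e2 : 3 * r * v (.inl false) = (r ^ 2 - 4 * q) * v (.inl true) := by
      linear_combination r * h2 - 2 * hsb
    have hnz : v (.inl false) ≠ 0 := by
      intro h0
      have h0' : v (.inl true) = 0 := by
        rw [h0] at e1
        have : 3 * r * v (.inl true) = 0 := by linarith
        rcases mul_eq_zero.1 this with h | h
        · linarith
        · exact h
      apply hv
      funext z
      rcases z with (_ | _) | a | b
      · exact h0
      · exact h0'
      · have := h3 a
        rw [h0] at this
        have : r * v (.inr (.inl a)) = 0 := by linarith
        exact (mul_eq_zero.1 this).resolve_left hr0.ne'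
      · have := h4 b
        rw [h0'] at this
        have : r * v (.inr (.inr b)) = 0 := by linarith
        exact (mul_eq_zero.1 this).resolve_left hr0.ne'
    have e3 : (r ^ 2 - 4 * p) * (r ^ 2 - 4 * q) = 9 * r ^ 2 := by
      have : ((r ^ 2 - 4 * p) * (r ^ 2 - 4 * q) - 9 * r ^ 2) * v (.inl false) = 0 := by
        linear_combination (-(r^2 - 4 * q)) * e1 - 3 * r * e2
      have := (mul_eq_zero.1 this).resolve_right hnz
      linarith
    have ht : s < r ^ 2 := by rw [← hl2]; nlinarith
    have hsn : 4 * (n : ℝ) + 1 ≤ 2 * s := by have := Real.sqrt_nonneg D; rw [hs]; linarith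
    have : (r ^ 2 - s) * (r ^ 2 + s - (4 * n + 1)) = 0 := by
      rw [← hn']; linear_combination e3 - hquad
    have : 0 < (r ^ 2 - s) * (r ^ 2 + s - (4 * n + 1)) := by
      apply mul_pos <;> linarith
    linarith

lemma ds_iso {V : Type} (T : SimpleGraph V) (u v : V) (huv : T.Adj u v)
    (hcov : ∀ w, w ≠ u → w ≠ v → (T.Adj u w ∧ ¬ T.Adj v w) ∨ (T.Adj v w ∧ ¬ T.Adj u w))
    (hleaf : ∀ w w', w ≠ u → w ≠ v → w' ≠ u → w' ≠ v → ¬ T.Adj w w') :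
    Nonempty (T ≃g MG {w // T.Adj u w ∧ w ≠ v} {w // T.Adj v w ∧ w ≠ u}) := by
  let f : Bool ⊕ ({w // T.Adj u w ∧ w ≠ v} ⊕ {w // T.Adj v w ∧ w ≠ u}) → V := fun z =>
    match z with
    | .inl false => u
    | .inl true => v
    | .inr (.inl a) => a.1
    | .inr (.inr b) => b.1
  have hA : ∀ w, T.Adj u w ∧ w ≠ v → w ≠ u ∧ w ≠ v ∧ T.Adj u w ∧ ¬ T.Adj v w := by
    intro w h
    have : w ≠ u := h.1.ne'
    have := hcov w this h.2
    tauto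
  have hB : ∀ w, T.Adj v w ∧ w ≠ u → w ≠ u ∧ w ≠ v ∧ T.Adj v w ∧ ¬ T.Adj u w := by
    intro w h
    have : w ≠ v := h.1.ne'
    have := hcov w h.2 this
    tauto
  have hne := huv.ne
  have hf : Function.Bijective f := by
    constructor
    · rintro ((_ | _) | ⟨a, ha⟩ | ⟨b, hb⟩) ((_ | _) | ⟨a', ha'⟩ | ⟨b', hb'⟩) h <;>
        simp only [f] at h <;> first | rfl | grind
    · intro w
      by_cases h1 : w = u
      · exact ⟨.inl false, h1.symm⟩
      by_cases h2 : w = v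
      · exact ⟨.inl true, h2.symm⟩
      rcases hcov w h1 h2 with h | h
      · exact ⟨.inr (.inl ⟨w, h.1, h2⟩), rfl⟩
      · exact ⟨.inr (.inr ⟨w, h.1, h1⟩), rfl⟩
  have key : ∀ z z', T.Adj (f z) (f z') ↔ mAdj z z' := by
    rintro ((_ | _) | ⟨a, ha⟩ | ⟨b, hb⟩) ((_ | _) | ⟨a', ha'⟩ | ⟨b', hb'⟩) <;>
      simp only [f, mAdj] <;> grind [SimpleGraph.adj_comm, SimpleGraph.irrefl]
  exact ⟨(RelIso.mk (Equiv.ofBijective f hf) (fun {a b} => key a b) : MG _ _ ≃g T).symm⟩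

lemma closer_unique {V : Type} {T : SimpleGraph V} (hT : T.IsTree) {r v a b : V}
    (ha : T.Adj a v) (hb : T.Adj b v) (hda : T.dist r v = T.dist r a + 1)
    (hdb : T.dist r v = T.dist r b + 1) : a = b := by
  obtain ⟨p, hp⟩ := hT.connected.exists_walk_length_eq_dist r a
  obtain ⟨q, hq⟩ := hT.connected.exists_walk_length_eq_dist r b
  have h1 : (p.concat ha).IsPath := by
    apply Walk.isPath_of_length_eq_dist
    rw [Walk.length_concat]; omega
  have h2 : (q.concat hb).IsPath := by
    apply Walk.isPath_of_length_eq_dist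
    rw [Walk.length_concat]; omega
  have h := (hT.existsUnique_path r v).unique h1 h2
  have := congrArg Walk.penultimate h
  simpa using this

lemma tree_struct {n : ℕ} (T : SimpleGraph (Fin n)) (hT : T.IsTree) (hd : gdiam T = 3) :
    ∃ u v : Fin n, ∃ x y : Fin n, T.Adj u v ∧ (T.Adj u x ∧ x ≠ v) ∧ (T.Adj v y ∧ y ≠ u) ∧
    (∀ w, w ≠ u → w ≠ v → (T.Adj u w ∧ ¬ T.Adj v w) ∨ (T.Adj v w ∧ ¬ T.Adj u w)) ∧
    (∀ w w', w ≠ u → w ≠ v → w' ≠ u → w' ≠ v → ¬ T.Adj w w') := by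
  have hle : ∀ a b, T.dist a b ≤ 3 := by
    intro a b
    rw [← hd]
    exact Finset.le_sup (f := fun p : Fin n × Fin n => T.dist p.1 p.2) (Finset.mem_univ (a, b))
  have hex : ∃ a b, T.dist a b = 3 := by
    by_contra hcon
    push Not at hcon
    have : gdiam T ≤ 2 := by
      apply Finset.sup_le
      intro p _
      have h1 := hle p.1 p.2
      have h2 := hcon p.1 p.2
      omega
    omega
  obtain ⟨x, y, hxy⟩ := hex
  obtain ⟨p, hp⟩ := hT.connected.exists_walk_length_eq_dist x y
  rw [hxy] at hp
  have hw : ∃ u v, T.Adj x u ∧ T.Adj u v ∧ T.Adj v y := by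
    match p, hp with
    | .cons ha (.cons hb (.cons hc .nil)), _ => exact ⟨_, _, ha, hb, hc⟩
  obtain ⟨u, v, hxu, huv, hvy⟩ := hw
  have tri := fun a b c => hT.connected.dist_triangle (u := a) (v := b) (w := c)
  have d1 : ∀ {a b}, T.Adj a b ↔ T.dist a b = 1 := fun {a b} => dist_eq_one_iff_adj.symm
  have hxv : x ≠ v := by
    rintro rfl
    have := d1.1 hvy
    omega
  have hyu : y ≠ u := by
    rintro rfl
    have := d1.1 hxu
    omega
  have dz : ∀ {a b}, T.dist a b = 0 → a = b := fun {a b} h => hT.connected.dist_eq_zero_iff.1 h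
  have far : ∀ (u v y w : Fin n), T.Adj u v → T.Adj v y → y ≠ u →
      T.dist w v = T.dist w u + 1 → w ≠ u → T.Adj u w ∧ ¬ T.Adj v w := by
    intro u v y w huv hvy hyu h hwu
    have h1 : T.dist w y = T.dist w v + 1 := by
      rcases hT.dist_eq_dist_add_one_of_adj w hvy with h2 | h2
      · exact absurd (closer_unique hT hvy.symm huv h2 h) hyu
      · exact h2
    have h2 := hle w y
    have h3 : T.dist w u ≠ 0 := fun h => hwu (dz h)
    have h4 : T.dist w u = 1 := by omega
    refine ⟨(d1.2 h4).symm, fun h5 => ?_⟩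
    have := d1.1 h5.symm
    omega
  have hcov : ∀ w, w ≠ u → w ≠ v →
      (T.Adj u w ∧ ¬ T.Adj v w) ∨ (T.Adj v w ∧ ¬ T.Adj u w) := by
    intro w hu hv
    rcases hT.dist_eq_dist_add_one_of_adj w huv with h | h
    · exact Or.inr (far v u x w huv.symm hxu.symm hxv h hv)
    · exact Or.inl (far u v y w huv hvy hyu h hu)
  have mix : ∀ u v w w' : Fin n, T.Adj u v → T.Adj u w → T.Adj v w' → ¬ T.Adj u w' → w' ≠ u →
      w ≠ v → ¬ T.Adj w w' := by
    intro u v w w' huv hw hw' hnw' hne hwv h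
    have a1 := d1.1 huv
    have a2 := d1.1 hw
    have a3 : T.dist u w' = 2 := my_dist2 huv hw' hne.symm hnw'
    exact hwv (closer_unique (r := u) hT h hw' (by omega) (by omega))
  refine ⟨u, v, x, y, huv, ⟨hxu.symm, hxv⟩, ⟨hvy, hyu⟩, hcov, ?_⟩
  intro w w' h1 h2 h3 h4 h
  rcases hcov w h1 h2 with ⟨a, b⟩ | ⟨a, b⟩ <;> rcases hcov w' h3 h4 with ⟨a', b'⟩ | ⟨a', b'⟩
  · exact hT.dist_ne_of_adj u h (by rw [d1.1 a, d1.1 a'])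
  · exact mix u v w w' huv a a' b' h3 h2 h
  · exact mix v u w w' huv.symm a a' b' h4 h1 h
  · exact hT.dist_ne_of_adj v h (by rw [d1.1 a, d1.1 a'])

def MG_congr {α β α' β' : Type} (f : α ≃ α') (g : β ≃ β') : MG α β ≃g MG α' β' :=
  RelIso.mk (Equiv.sumCongr (Equiv.refl _) (Equiv.sumCongr f g)) (by
    rintro (a | a | a) (b | b | b) <;> rfl)

def MG_swap {α β : Type} : MG α β ≃g MG β α :=
  RelIso.mk (Equiv.sumCongr Equiv.boolNot (Equiv.sumComm _ _)) (by
    rintro ((_ | _) | a | a) ((_ | _) | b | b) <;> simp [MG, mAdj])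

lemma tree_iso {n : ℕ} (T : SimpleGraph (Fin n)) (hT : T.IsTree) (hd : gdiam T = 3) :
    ∃ p q : ℕ, 0 < p ∧ 0 < q ∧ Nonempty (T ≃g MG (Fin p) (Fin q)) := by
  classical
  obtain ⟨u, v, x, y, huv, hx, hy, hcov, hleaf⟩ := tree_struct T hT hd
  obtain ⟨e⟩ := ds_iso T u v huv hcov hleaf
  exact ⟨_, _, Fintype.card_pos_iff.2 ⟨⟨x, hx⟩⟩, Fintype.card_pos_iff.2 ⟨⟨y, hy⟩⟩,
    ⟨e.trans (MG_congr (Fintype.equivFin _) (Fintype.equivFin _))⟩⟩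

lemma Tnd_iso {n : ℕ} (a : ℕ) (ha : a + 4 ≤ n) :
    Nonempty (Tnd n 3 a ≃g MG (Fin (a + 1)) (Fin (n - 3 - a))) := by
  classical
  have hadj : ∀ x y : Fin n, (Tnd n 3 a).Adj x y ↔ x.val ≠ y.val ∧
    (((x.val + 1 = y.val ∧ y.val ≤ 3) ∨ (x.val = 1 ∧ 3 < y.val ∧ y.val ≤ 3 + a) ∨
      (x.val = 2 ∧ 3 + a < y.val)) ∨
    ((y.val + 1 = x.val ∧ x.val ≤ 3) ∨ (y.val = 1 ∧ 3 < x.val ∧ x.val ≤ 3 + a) ∨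
      (y.val = 2 ∧ 3 + a < x.val))) := by
    intro x y
    simp [Tnd, SimpleGraph.fromRel_adj, Fin.ext_iff]
  let u : Fin n := ⟨1, by omega⟩
  let v : Fin n := ⟨2, by omega⟩
  have hu : u.val = 1 := rfl
  have hv : v.val = 2 := rfl
  obtain ⟨e⟩ := ds_iso (Tnd n 3 a) u v (by rw [hadj]; omega)
    (by
      intro w h1 h2
      rw [Ne, Fin.ext_iff] at h1 h2
      rw [hadj, hadj]
      omega)
    (by
      intro w w' h1 h2 h3 h4
      rw [Ne, Fin.ext_iff] at h1 h2 h3 h4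
      rw [hadj]
      omega)
  have hc : Fintype.card {w // (Tnd n 3 a).Adj u w ∧ w ≠ v} = a + 1 := by
    have hmem : ∀ i : Fin (a + 1), ∃ w : {w // (Tnd n 3 a).Adj u w ∧ w ≠ v},
        w.1.val = if i.val = 0 then 0 else i.val + 3 := by
      intro i
      have := i.isLt
      refine ⟨⟨⟨if i.val = 0 then 0 else i.val + 3, by split_ifs <;> omega⟩, ?_⟩, rfl⟩
      rw [hadj, ← Fin.val_ne_iff]
      dsimp only
      split_ifs <;> omega
    choose g hg using hmem
    rw [← Fintype.card_fin (a + 1)]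
    refine (Fintype.card_congr (Equiv.ofBijective g ⟨?_, ?_⟩)).symm
    · intro i j h
      have h := congrArg (fun w => w.1.val) h
      simp only [hg] at h
      apply Fin.ext
      split_ifs at h <;> omega
    · rintro ⟨w, hw⟩
      have hw' := hw
      rw [hadj, ← Fin.val_ne_iff] at hw'
      refine ⟨⟨w.val - 3, by omega⟩, ?_⟩
      apply Subtype.ext
      apply Fin.ext
      rw [hg]
      dsimp only
      split_ifs <;> omega
  have hc2 : Fintype.card {w // (Tnd n 3 a).Adj v w ∧ w ≠ u} = n - 3 - a := by
    have := Fintype.card_congr e.toEquiv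
    rw [Fintype.card_sum, Fintype.card_sum, hc] at this
    simp only [Fintype.card_fin, Fintype.card_bool] at this
    omega
  exact ⟨e.trans (MG_congr (Fintype.equivFinOfCardEq hc) (Fintype.equivFinOfCardEq hc2))⟩

lemma RR_lt {n p q p' q' : ℕ} (h' : p' + q' + 2 = n) (hlt : p * q < p' * q') :
    RR n p' q' < RR n p q := by
  unfold RR
  have h1 : (p : ℝ) * q < p' * q' := by exact_mod_cast hlt
  have h2 : (p' : ℝ) + q' + 2 = n := by exact_mod_cast h'
  have hp : (0 : ℝ) ≤ p' := by positivity
  have hq : (0 : ℝ) ≤ q' := by positivity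
  have hn : (0 : ℝ) ≤ n := by positivity
  have h0 : 0 ≤ (4 * (n : ℝ) + 1) ^ 2 - 64 * (p' * q') := by
    rw [← h2]; nlinarith [sq_nonneg ((p' : ℝ) - q')]
  have h3 := Real.sqrt_lt_sqrt h0 (show (4 * (n : ℝ) + 1) ^ 2 - 64 * (p' * q') <
    (4 * (n : ℝ) + 1) ^ 2 - 64 * (p * q) by linarith)
  have h4 := Real.sqrt_nonneg ((4 * (n : ℝ) + 1) ^ 2 - 64 * (p' * q'))
  exact Real.sqrt_lt_sqrt (by linarith) (by linarith)

lemma nat_opt {p q p0 q0 : ℕ} (h : p + q = p0 + q0) (h1 : p0 ≤ q0) (h2 : q0 ≤ p0 + 1) :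
    (p = p0 ∧ q = q0) ∨ (p = q0 ∧ q = p0) ∨ p * q < p0 * q0 := by
  rcases lt_or_ge p p0 with h3 | h3
  · obtain ⟨d, rfl⟩ := Nat.exists_eq_add_of_lt h3
    obtain rfl : q = q0 + d + 1 := by omega
    right; right
    nlinarith
  · rcases lt_or_ge q p0 with h4 | h4
    · obtain ⟨d, rfl⟩ := Nat.exists_eq_add_of_lt h4
      obtain rfl : p = q0 + d + 1 := by omega
      right; right
      nlinarith
    · omega

/-- Corollary 3.3: minimum `𝓔`-spectral radius among complements of trees of
diameter `3`. -/
theorem stmt_2 {n : ℕ} (T : SimpleGraph (Fin n)) (hT : T.IsTree) (hd : gdiam T = 3) (B : ℝ)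
    (hB : B = if Even n then Real.sqrt ((4 * (n : ℝ) + 1 + Real.sqrt (72 * (n : ℝ) - 63)) / 2)
      else Real.sqrt ((4 * (n : ℝ) + 1 + Real.sqrt (72 * (n : ℝ) - 47)) / 2)) :
    B ≤ xi Tᶜ 1 ∧ (xi Tᶜ 1 = B ↔ Nonempty (T ≃g Tnd n 3 ((n - 4) / 2))) := by
  obtain ⟨p, q, hp, hq, ⟨e⟩⟩ := tree_iso T hT hd
  obtain ⟨hn, hxi⟩ := compl_xi T e (by simpa using hp) (by simpa using hq)
  simp only [Fintype.card_fin] at hn hxi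
  obtain ⟨e0⟩ := Tnd_iso (n := n) ((n - 4) / 2) (by omega)
  have hB' : B = RR n ((n - 4) / 2 + 1) (n - 3 - (n - 4) / 2) := by
    rw [hB]
    unfold RR
    split_ifs with hev
    · obtain ⟨k, hk⟩ := hev
      obtain ⟨j, rfl⟩ : ∃ j, k = j + 2 := ⟨k - 2, by omega⟩
      have h1 : (n - 4) / 2 = j := by omega
      have h2 : n - 3 - j = j + 1 := by omega
      rw [h1, h2, hk]
      congr 4
      push_cast
      ring
    · rw [Nat.not_even_iff_odd] at hev
      obtain ⟨k, hk⟩ := hev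
      obtain ⟨j, rfl⟩ : ∃ j, k = j + 2 := ⟨k - 2, by omega⟩
      have h1 : (n - 4) / 2 = j := by omega
      have h2 : n - 3 - j = j + 2 := by omega
      rw [h1, h2, hk]
      congr 4
      push_cast
      ring
  have hopt := nat_opt (p := p) (q := q) (p0 := (n - 4) / 2 + 1) (q0 := n - 3 - (n - 4) / 2)
    (by omega) (by omega) (by omega)
  rw [hxi]
  constructor
  · rw [hB']
    rcases hopt with ⟨rfl, rfl⟩ | ⟨h1, h2⟩ | h
    · exact le_rfl
    · rw [h1, h2]; unfold RR; rw [mul_comm ((n - 3 - (n - 4) / 2 : ℕ) : ℝ)]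
    · exact (RR_lt (by omega) h).le
  · constructor
    · intro heq
      rcases hopt with ⟨h1, h2⟩ | ⟨h1, h2⟩ | h
      · subst h1 h2
        exact ⟨e.trans e0.symm⟩
      · subst h1 h2
        exact ⟨(e.trans MG_swap).trans e0.symm⟩
      · have := RR_lt (n := n) (by omega) h
        rw [heq, hB'] at this
        exact absurd this (lt_irrefl _)
    · rintro ⟨f⟩
      obtain ⟨-, h⟩ := compl_xi T (f.trans e0) (by simp) (by simp; omega)
      simp only [Fintype.card_fin] at h
      rw [← hxi, h, hB']
end
end

section
/- Let T be a tree on n vertices with diameter 3. Then E_𝓔(T^c) ≥ 2·sqrt(4n+1+8·sqrt(n−3)), with equality if and only if T is isomorphic to T_{n,3}^{0,n−4}. -/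
noncomputable section

open SimpleGraph

structure DS {n : ℕ} (T : SimpleGraph (Fin n)) (c d : Fin n) : Prop where
  cd : T.Adj c d
  hor : ∀ v, v ≠ c → v ≠ d → T.Adj c v ∨ T.Adj d v
  nand : ∀ v, T.Adj c v → T.Adj d v → False
  no : ∀ u v, u ≠ c → u ≠ d → v ≠ c → v ≠ d → ¬ T.Adj u v
  exc : ∃ x, x ≠ d ∧ T.Adj c x
  exd : ∃ x, x ≠ c ∧ T.Adj d x

lemma DS.symm {n : ℕ} {T : SimpleGraph (Fin n)} {c d : Fin n} (h : DS T c d) : DS T d c where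
  cd := h.cd.symm
  hor v h1 h2 := (h.hor v h2 h1).symm
  nand v h1 h2 := h.nand v h2 h1
  no u v h1 h2 h3 h4 := h.no u v h2 h1 h4 h3
  exc := h.exd
  exd := h.exc

lemma tree_path_len {n : ℕ} {T : SimpleGraph (Fin n)} (hT : T.IsTree) {u v : Fin n}
    (p : T.Walk u v) (hp : p.IsPath) : p.length = T.dist u v := by
  obtain ⟨q, hq, hl⟩ := hT.1.exists_path_of_dist u v
  have := (hT.2.subsingleton_path u v).elim ⟨p, hp⟩ ⟨q, hq⟩
  have h2 : p = q := congrArg Subtype.val this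
  rw [h2, hl]

lemma gd_le {n : ℕ} (T : SimpleGraph (Fin n)) (u v : Fin n) : T.dist u v ≤ gdiam T :=
  Finset.le_sup (f := fun p : Fin n × Fin n => T.dist p.1 p.2) (Finset.mem_univ (u, v))

lemma exists_DS {n : ℕ} (T : SimpleGraph (Fin n)) (hT : T.IsTree) (hd : gdiam T = 3) :
    ∃ c d, DS T c d := by
  have hex : ∃ u v, T.dist u v = 3 := by
    have hne : (Finset.univ : Finset (Fin n × Fin n)).Nonempty := by
      obtain ⟨v⟩ := hT.1.nonempty
      exact ⟨(v, v), Finset.mem_univ _⟩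
    obtain ⟨p, -, hp⟩ := Finset.exists_mem_eq_sup _ hne
      (fun p : Fin n × Fin n => T.dist p.1 p.2)
    exact ⟨p.1, p.2, by rw [← hd]; exact hp.symm⟩
  obtain ⟨x, y, hxy⟩ := hex
  obtain ⟨q, hq, hl⟩ := hT.1.exists_path_of_dist x y
  rw [hxy] at hl
  obtain ⟨c, d, h1, h2, h3⟩ : ∃ c d, T.Adj x c ∧ T.Adj c d ∧ T.Adj d y := by
    cases q with
    | nil => simp at hl
    | cons a q => cases q with
      | nil => simp at hl
      | cons b q => cases q with
        | nil => simp at hl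
        | cons e q => cases q with
          | nil => exact ⟨_, _, a, b, e⟩
          | cons f q => simp at hl
  have hxy' : x ≠ y := by rintro rfl; simp at hxy
  have hxd : x ≠ d := by
    rintro rfl
    rw [dist_eq_one_iff_adj.2 h3] at hxy; omega
  have hcy : c ≠ y := by
    rintro rfl
    rw [dist_eq_one_iff_adj.2 h1] at hxy; omega
  have tri : ∀ a b e, T.Adj a b → T.Adj b e → T.Adj a e → False := by
    intro a b e h h' h''
    have := tree_path_len hT (.cons h (.cons h' .nil)) (by
      simp [h.ne, h'.ne, h''.ne])
    rw [dist_eq_one_iff_adj.2 h''] at this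
    simp at this
  have quad : ∀ a b e f, T.Adj a b → T.Adj b e → T.Adj e f → T.Adj a f → a ≠ e → b ≠ f → False := by
    intro a b e f h h' h'' h3 h4 h5
    have := tree_path_len hT (.cons h (.cons h' (.cons h'' .nil))) (by
      simp [h.ne, h'.ne, h''.ne, h3.ne, h4, h5])
    rw [dist_eq_one_iff_adj.2 h3] at this
    simp at this
  have p4 : ∀ a b e f g, T.Adj a b → T.Adj b e → T.Adj e f → T.Adj f g →
      a ≠ e → a ≠ f → a ≠ g → b ≠ f → b ≠ g → e ≠ g → False := by
    intro a b e f g h h' h'' h3 h4 h5 h6 h7 h8 h9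
    have := tree_path_len hT (.cons h (.cons h' (.cons h'' (.cons h3 .nil)))) (by
      simp [h.ne, h'.ne, h''.ne, h3.ne, h4, h5, h6, h7, h8, h9])
    have h0 := gd_le T a g
    simp at this
    omega
  have nand : ∀ v, T.Adj c v → T.Adj d v → False := fun v hv hv' => tri c d v h2 hv' hv
  have hor : ∀ v, v ≠ c → v ≠ d → T.Adj c v ∨ T.Adj d v := by
    intro v hvc hvd
    by_contra hcon
    obtain ⟨w⟩ := hT.1.preconnected c v
    obtain ⟨⟨⟨u, w⟩, hadj⟩, -, hu, hw⟩ := w.exists_boundary_dart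
      {v | v = c ∨ v = d ∨ T.Adj c v ∨ T.Adj d v} (by simp) (by simp [hvc, hvd]; tauto)
    simp only [Set.mem_ofPred_eq, not_or] at hu hw hadj
    obtain ⟨w1, w2, w3, w4⟩ := hw
    rcases hu with rfl | rfl | hu | hu
    · exact w3 hadj
    · exact w4 hadj
    · refine p4 w u c d y hadj.symm hu.symm h2 h3 w1 w2 ?_ ?_ ?_ hcy
      · rintro rfl; exact w4 h3
      · rintro rfl; exact w4 hadj
      · rintro rfl; exact nand _ hu h3
    · refine p4 w u d c x hadj.symm hu.symm h2.symm h1.symm w2 w1 ?_ ?_ ?_ hxd.symm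
      · rintro rfl; exact w3 h1.symm
      · rintro rfl; exact w3 hadj
      · rintro rfl; exact nand _ h1.symm hu
  refine ⟨c, d, h2, hor, nand, ?_, ⟨x, hxd, h1.symm⟩, ⟨y, hcy.symm, h3⟩⟩
  intro u v hu hu' hv hv' huv
  rcases hor u hu hu' with h | h <;> rcases hor v hv hv' with h' | h'
  · exact tri _ _ _ h.symm h' huv
  · exact quad u c d v h.symm h2 h' huv hu' hv.symm
  · exact quad u d c v h.symm h2.symm h' huv hu hv'.symm
  · exact tri _ _ _ h.symm h' huv

section
variable {n : ℕ} {T : SimpleGraph (Fin n)} {c d : Fin n}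

lemma DS.cadj (h : DS T c d) {v : Fin n} (hv : v ≠ c) (hn : ¬ T.Adj c v) : Tᶜ.dist c v = 1 := by
  rw [dist_eq_one_iff_adj, compl_adj]; exact ⟨hv.symm, hn⟩

lemma DS.ll (h : DS T c d) {u v : Fin n} (huv : u ≠ v) (h1 : u ≠ c) (h2 : u ≠ d) (h3 : v ≠ c)
    (h4 : v ≠ d) : Tᶜ.dist u v = 1 := by
  rw [dist_eq_one_iff_adj, compl_adj]; exact ⟨huv, h.no u v h1 h2 h3 h4⟩

lemma DS.c2 (h : DS T c d) {v : Fin n} (hv : v ≠ d) (ha : T.Adj c v) : Tᶜ.dist c v = 2 := by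
  obtain ⟨y, hy, hdy⟩ := h.exd
  have hyv : y ≠ v := by rintro rfl; exact h.nand _ ha hdy
  have a1 : Tᶜ.Adj c y := by
    rw [compl_adj]; exact ⟨hy.symm, fun h' => h.nand _ h' hdy⟩
  have a2 : Tᶜ.Adj y v := by
    rw [compl_adj]; exact ⟨hyv, h.no y v hy hdy.ne' ha.ne' hv⟩
  have le : Tᶜ.dist c v ≤ 2 := dist_le (.cons a1 (.cons a2 .nil))
  have r : Tᶜ.Reachable c v := ⟨.cons a1 (.cons a2 .nil)⟩
  have n0 : Tᶜ.dist c v ≠ 0 := fun h0 => ha.ne (r.dist_eq_zero_iff.1 h0)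
  have n1 : Tᶜ.dist c v ≠ 1 := by
    rw [Ne, dist_eq_one_iff_adj, compl_adj]; tauto
  omega

lemma DS.cd3 (h : DS T c d) : Tᶜ.dist c d = 3 := by
  obtain ⟨y, hy, hdy⟩ := h.exd
  obtain ⟨x, hx, hcx⟩ := h.exc
  have hyx : y ≠ x := by rintro rfl; exact h.nand _ hcx hdy
  have a1 : Tᶜ.Adj c y := by
    rw [compl_adj]; exact ⟨hy.symm, fun h' => h.nand _ h' hdy⟩
  have a2 : Tᶜ.Adj y x := by
    rw [compl_adj]; exact ⟨hyx, h.no y x hy hdy.ne' hcx.ne' hx⟩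
  have a3 : Tᶜ.Adj x d := by
    rw [compl_adj]; exact ⟨hx, fun h' => h.nand _ hcx h'.symm⟩
  have le : Tᶜ.dist c d ≤ 3 := dist_le (.cons a1 (.cons a2 (.cons a3 .nil)))
  have r : Tᶜ.Reachable c d := ⟨.cons a1 (.cons a2 (.cons a3 .nil))⟩
  have n0 : Tᶜ.dist c d ≠ 0 := fun h0 => h.cd.ne (r.dist_eq_zero_iff.1 h0)
  have n1 : Tᶜ.dist c d ≠ 1 := by
    rw [Ne, dist_eq_one_iff_adj, compl_adj]; have := h.cd; tauto
  have n2 : Tᶜ.dist c d ≠ 2 := by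
    intro h2
    obtain ⟨w, hw⟩ := r.exists_walk_length_eq_dist
    rw [h2] at hw
    cases w with
    | nil => simp at hw
    | cons a q => cases q with
      | nil => simp at hw
      | cons b q => cases q with
        | nil =>
          rw [compl_adj] at a b
          rcases h.hor _ a.1.symm b.1 with h' | h'
          · exact a.2 h'
          · exact b.2 h'.symm
        | cons f q => simp at hw
  omega

lemma le_ecc (G : SimpleGraph (Fin n)) (u v : Fin n) : G.dist u v ≤ ecc G u :=
  Finset.le_sup (f := fun v => G.dist u v) (Finset.mem_univ v)

lemma DS.ecc_c (h : DS T c d) : ecc Tᶜ c = 3 := by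
  apply le_antisymm
  · apply Finset.sup_le
    intro v _
    by_cases h1 : v = c
    · subst h1; simp
    by_cases h2 : v = d
    · subst h2; exact h.cd3.le
    by_cases h3 : T.Adj c v
    · rw [h.c2 h2 h3]; omega
    · rw [h.cadj h1 h3]; omega
  · rw [← h.cd3]; exact le_ecc _ _ _

lemma DS.ecc_leaf' (h : DS T c d) {v : Fin n} (hv : v ≠ d) (ha : T.Adj c v) : ecc Tᶜ v = 2 := by
  apply le_antisymm
  · apply Finset.sup_le
    intro w _
    by_cases h1 : w = c
    · subst h1; rw [SimpleGraph.dist_comm, h.c2 hv ha]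
    by_cases h2 : w = d
    · subst h2; rw [SimpleGraph.dist_comm, h.symm.cadj hv (fun h' => h.nand _ ha h')]; omega
    by_cases h3 : v = w
    · subst h3; simp
    · rw [h.ll h3 ha.ne' hv h1 h2]; omega
  · rw [← h.c2 hv ha, SimpleGraph.dist_comm]; exact le_ecc _ _ _

lemma DS.ecc_leaf (h : DS T c d) {v : Fin n} (h1 : v ≠ c) (h2 : v ≠ d) : ecc Tᶜ v = 2 := by
  rcases h.hor v h1 h2 with h' | h'
  · exact h.ecc_leaf' h2 h'
  · exact h.symm.ecc_leaf' h1 h'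

lemma eccM_symm (G : SimpleGraph (Fin n)) (u v : Fin n) : eccMatrix G u v = eccMatrix G v u := by
  unfold eccMatrix
  simp only [SimpleGraph.dist_comm (u := u) (v := v), min_comm (ecc G u), ne_comm (a := u)]

lemma DS.m_cd (h : DS T c d) : eccMatrix Tᶜ c d = 3 := by
  unfold eccMatrix
  rw [h.ecc_c, h.symm.ecc_c, h.cd3]; simp [h.cd.ne]

lemma DS.m_ll (h : DS T c d) {u v : Fin n} (h1 : u ≠ c) (h2 : u ≠ d) (h3 : v ≠ c)
    (h4 : v ≠ d) : eccMatrix Tᶜ u v = 0 := by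
  unfold eccMatrix
  rw [h.ecc_leaf h1 h2, h.ecc_leaf h3 h4]
  apply if_neg
  rintro ⟨h5, h6⟩
  rw [h.ll h5 h1 h2 h3 h4] at h6; simp at h6

lemma m_diag (G : SimpleGraph (Fin n)) (u : Fin n) : eccMatrix G u u = 0 := by
  simp [eccMatrix]

open Classical in
/-- leaves at c -/
def lv (T : SimpleGraph (Fin n)) (c d : Fin n) : Finset (Fin n) :=
  Finset.univ.filter fun v => v ≠ d ∧ T.Adj c v

lemma mem_lv {v : Fin n} : v ∈ lv T c d ↔ v ≠ d ∧ T.Adj c v := by simp [lv]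

lemma DS.m_c (h : DS T c d) {v : Fin n} (h1 : v ≠ c) (h2 : v ≠ d) :
    eccMatrix Tᶜ c v = if v ∈ lv T c d then 2 else 0 := by
  unfold eccMatrix
  rw [h.ecc_c, h.ecc_leaf h1 h2]
  split_ifs with h3 h4 h4
  · rw [h.c2 h2 (mem_lv.1 h4).2]; simp
  · rw [h.cadj h1 (fun h5 => h4 (mem_lv.2 ⟨h2, h5⟩))] at h3; simp at h3
  · rw [h.c2 h2 (mem_lv.1 h4).2] at h3; simp [h1.symm] at h3
  · rfl

lemma DS.card (h : DS T c d) : (lv T c d).card + (lv T d c).card + 2 = n := by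
  have hdis : Disjoint (lv T c d) (lv T d c) := by
    rw [Finset.disjoint_left]
    intro v h1 h2
    exact h.nand _ (mem_lv.1 h1).2 (mem_lv.1 h2).2
  have hdis2 : Disjoint (lv T c d ∪ lv T d c) {c, d} := by
    rw [Finset.disjoint_left]
    intro v h1 h2
    simp only [Finset.mem_union, mem_lv, Finset.mem_insert, Finset.mem_singleton] at h1 h2
    rcases h2 with rfl | rfl <;> simp at h1
  have hu : (lv T c d ∪ lv T d c) ∪ {c, d} = Finset.univ := by
    ext v
    simp only [Finset.mem_union, mem_lv, Finset.mem_insert, Finset.mem_singleton,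
      Finset.mem_univ, iff_true]
    have := h.hor v
    tauto
  have := congrArg Finset.card hu
  rw [Finset.card_union_of_disjoint hdis2, Finset.card_union_of_disjoint hdis,
    Finset.card_pair h.cd.ne] at this
  simpa using this

lemma DS.one_le (h : DS T c d) : 1 ≤ (lv T c d).card := by
  obtain ⟨x, hx⟩ := h.exc
  exact Finset.card_pos.2 ⟨x, mem_lv.2 hx⟩

def fU (T : SimpleGraph (Fin n)) (c d : Fin n) : Matrix (Fin n) (Fin 4) ℝ :=
  fun v => ![if v = c then 1 else 0, if v = d then 1 else 0,
    if v ∈ lv T c d then 2 else 0, if v ∈ lv T d c then 2 else 0]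

def fV (T : SimpleGraph (Fin n)) (c d : Fin n) : Matrix (Fin 4) (Fin n) ℝ :=
  ![fun v => (if v ∈ lv T c d then 2 else 0) + 3 * (if v = d then 1 else 0),
    fun v => (if v ∈ lv T d c then 2 else 0) + 3 * (if v = c then 1 else 0),
    fun v => if v = c then 1 else 0, fun v => if v = d then 1 else 0]

lemma DS.fact (h : DS T c d) : eccMatrix Tᶜ = fU T c d * fV T c d := by
  have hne := h.cd.ne
  ext u v
  rw [Matrix.mul_apply, Fin.sum_univ_four]
  simp only [fU, fV]
  by_cases u1 : u = c
  · subst u1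
    by_cases v1 : v = u
    · subst v1; simp [mem_lv, m_diag, hne]
    by_cases v2 : v = d
    · subst v2; simp [mem_lv, h.m_cd, hne, hne.symm]
    · simp [h.m_c v1 v2, v1, v2, hne, (show u ∉ lv T d u by simp [mem_lv])]
  by_cases u2 : u = d
  · subst u2
    by_cases v1 : v = u
    · subst v1; simp [mem_lv, m_diag, hne.symm]
    by_cases v2 : v = c
    · subst v2; simp [mem_lv, h.symm.m_cd, hne, hne.symm]
    · simp [h.symm.m_c v1 v2, v1, v2, hne.symm, (show u ∉ lv T c u by simp [mem_lv])]
  by_cases v1 : v = c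
  · subst v1
    rw [eccM_symm, h.m_c u1 u2]
    simp [u1, u2, hne]
  by_cases v2 : v = d
  · subst v2
    rw [eccM_symm, h.symm.m_c u2 u1]
    simp [u1, u2, hne.symm]
  rw [h.m_ll u1 u2 v1 v2]
  simp [mem_lv, u1, u2, v1, v2]

lemma DS.VU (h : DS T c d) : fV T c d * fU T c d =
    !![0, 3, 4 * ((lv T c d).card : ℝ), 0; 3, 0, 0, 4 * ((lv T d c).card : ℝ);
       1, 0, 0, 0; 0, 1, 0, 0] := by
  have hne := h.cd.ne
  have hcc : c ∉ lv T c d := by simp [mem_lv]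
  have hdd : d ∉ lv T d c := by simp [mem_lv]
  have hcd : c ∉ lv T d c := by simp [mem_lv]
  have hdc : d ∉ lv T c d := by simp [mem_lv]
  have hx : ∀ v, v ∈ lv T c d → v ∉ lv T d c := fun v h1 h2 =>
    h.nand _ (mem_lv.1 h1).2 (mem_lv.1 h2).2
  have i1 : lv T c d ∩ lv T d c = ∅ := by
    ext v; have := hx v; simp; tauto
  have i2 : lv T d c ∩ lv T c d = ∅ := by rw [Finset.inter_comm, i1]
  ext i j
  rw [Matrix.mul_apply]
  fin_cases i <;> fin_cases j <;>
    simp [fU, fV, add_mul, Finset.sum_add_distrib, i1, i2, hcc, hdd, hcd, hdc, hne,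
      hne.symm] <;> ring

lemma charpoly4 (p q s t : ℝ) (h1 : s ^ 2 + t ^ 2 = 9 + 4 * p + 4 * q)
    (h2 : (s * t) ^ 2 = 16 * p * q) :
    (!![0, 3, 4 * p, 0; 3, 0, 0, 4 * q; 1, 0, 0, 0; 0, 1, 0, 0] : Matrix (Fin 4) (Fin 4) ℝ).charpoly
    = (({s, -s, t, -t} : Multiset ℝ).map fun a => Polynomial.X - Polynomial.C a).prod := by
  apply Polynomial.funext
  intro x
  rw [Matrix.eval_charpoly]
  simp [Matrix.det_succ_row_zero, Fin.sum_univ_succ, Fin.succAbove, Matrix.scalar_apply]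
  linear_combination x ^ 2 * h1 - h2

lemma DS.energy (h : DS T c d) : eccEnergy Tᶜ = 2 * Real.sqrt (4 * (n : ℝ) + 1 +
    8 * Real.sqrt (((lv T c d).card * (lv T d c).card : ℕ) : ℝ)) := by
  have hc := h.card
  have hp := h.one_le
  have hq := h.symm.one_le
  have e1 := h.VU
  have e2 := h.fact
  set p := (lv T c d).card
  set q := (lv T d c).card
  have hn : (n : ℝ) = p + q + 2 := by exact_mod_cast hc.symm
  set r := Real.sqrt ((p * q : ℕ) : ℝ) with hr
  have hr0 : 0 ≤ r := Real.sqrt_nonneg _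
  have hr2 : r ^ 2 = p * q := by rw [hr, Real.sq_sqrt (by positivity)]; push_cast; rfl
  have hle : 8 * r ≤ 4 * n + 1 := by
    rw [hn]
    nlinarith [sq_nonneg ((p : ℝ) - q), Nat.cast_nonneg (α := ℝ) p, Nat.cast_nonneg (α := ℝ) q, abs_le_of_sq_le_sq' (show (2 * r) ^ 2 ≤ ((p : ℝ) + q) ^ 2 by nlinarith [sq_nonneg ((p : ℝ) - q)]) (by positivity)]
  set S := Real.sqrt (4 * (n : ℝ) + 1 + 8 * r) with hS
  set D := Real.sqrt (4 * (n : ℝ) + 1 - 8 * r) with hD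
  have hS2 : S ^ 2 = 4 * (n : ℝ) + 1 + 8 * r := Real.sq_sqrt (by positivity)
  have hD2 : D ^ 2 = 4 * (n : ℝ) + 1 - 8 * r := Real.sq_sqrt (by linarith)
  have hD0 : 0 ≤ D := Real.sqrt_nonneg _
  have hDS : D ≤ S := Real.sqrt_le_sqrt (by linarith)
  unfold eccEnergy eccEigs
  rw [e2, Matrix.charpoly_mul_comm_of_le _ _ (by simp; omega), e1,
    charpoly4 p q ((S + D) / 2) ((S - D) / 2) (by linear_combination (hS2 + hD2) / 2 + 4 * hn)
      (by
        have : (S + D) / 2 * ((S - D) / 2) = 4 * r := by linear_combination (hS2 - hD2) / 4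
        rw [this]; linear_combination 16 * hr2)]
  rw [Polynomial.roots_mul, Polynomial.roots_X_pow, Polynomial.roots_multiset_prod_X_sub_C]
  · rw [Multiset.map_add, Multiset.sum_add, Multiset.map_nsmul, Multiset.sum_nsmul]
    have a1 : |(S + D) / 2| = (S + D) / 2 := abs_of_nonneg (by linarith)
    have a2 : |(S - D) / 2| = (S - D) / 2 := abs_of_nonneg (by linarith)
    simp only [Multiset.insert_eq_cons, Multiset.map_cons, Multiset.sum_cons,
      Multiset.map_singleton, Multiset.sum_singleton, abs_neg, a1, a2, abs_zero, smul_zero]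
    ring
  · apply mul_ne_zero (pow_ne_zero _ Polynomial.X_ne_zero)
    exact (Polynomial.monic_multiset_prod_of_monic _ _ fun a _ => Polynomial.monic_X_sub_C a).ne_zero

lemma tnd_adj (n : ℕ) (u v : Fin n) : (Tnd n 3 0).Adj u v ↔
    ((u.val = 0 ∧ v.val = 1) ∨ (u.val = 1 ∧ v.val = 2) ∨ (u.val = 2 ∧ 3 ≤ v.val)) ∨
    ((v.val = 0 ∧ u.val = 1) ∨ (v.val = 1 ∧ u.val = 2) ∨ (v.val = 2 ∧ 3 ≤ u.val)) := by
  unfold Tnd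
  rw [SimpleGraph.fromRel_adj, Ne, Fin.ext_iff]
  omega

lemma iso_of (h : DS T c d) (h1 : (lv T c d).card = 1) : Nonempty (T ≃g Tnd n 3 0) := by
  classical
  obtain ⟨x, hx⟩ := Finset.card_eq_one.1 h1
  have hx' : ∀ v, (v ≠ d ∧ T.Adj c v) ↔ v = x := by
    intro v; rw [← mem_lv, hx, Finset.mem_singleton]
  have hn : 4 ≤ n := by have := h.card; have := h.symm.one_le; omega
  have hxx := (hx' x).2 rfl
  have hxc := hxx.2.ne'
  have hcd := h.cd.ne
  obtain ⟨g, hg⟩ := Finset.exists_equiv_extend_of_card_eq (α := Fin n) (β := Fin n)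
    (t := Finset.univ) (by simp) (s := {x, c, d})
    (f := fun v => if v = x then ⟨0, by omega⟩ else if v = c then ⟨1, by omega⟩ else ⟨2, by omega⟩)
    (by simp) (by
      intro a ha b hb hab
      simp at ha hb
      rcases ha with rfl | rfl | rfl <;> rcases hb with rfl | rfl | rfl <;>
        simp_all [eq_comm])
  let e : Fin n ≃ Fin n := g.trans (Equiv.subtypeUnivEquiv (by simp))
  have ex : (e x).val = 0 := by
    have := hg x (by simp); simp at this; simp [e, this]
  have ec : (e c).val = 1 := by
    have := hg c (by simp); simp [hxc.symm] at this; simp [e, this]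
  have ed : (e d).val = 2 := by
    have := hg d (by simp); simp [hxx.1.symm, hcd.symm] at this; simp [e, this]
  have ix : ∀ v, (e v).val = 0 ↔ v = x := fun v => by
    rw [← ex, ← Fin.ext_iff, e.injective.eq_iff]
  have ic : ∀ v, (e v).val = 1 ↔ v = c := fun v => by
    rw [← ec, ← Fin.ext_iff, e.injective.eq_iff]
  have id : ∀ v, (e v).val = 2 ↔ v = d := fun v => by
    rw [← ed, ← Fin.ext_iff, e.injective.eq_iff]
  have i3 : ∀ v, 3 ≤ (e v).val ↔ v ≠ x ∧ v ≠ c ∧ v ≠ d := fun v => by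
    rw [Ne, Ne, Ne, ← ix, ← ic, ← id]; omega
  refine ⟨⟨e, ?_⟩⟩
  intro u v
  rw [tnd_adj]
  simp only [ix, ic, id, i3]
  have key : ∀ v, T.Adj d v ↔ v = c ∨ (v ≠ x ∧ v ≠ c ∧ v ≠ d) := by
    intro v
    constructor
    · intro hv
      by_cases hvc : v = c
      · exact Or.inl hvc
      · refine Or.inr ⟨?_, hvc, hv.ne'⟩
        rintro rfl; exact h.nand _ hxx.2 hv
    · rintro (rfl | ⟨a, b, e⟩)
      · exact h.cd.symm
      · rcases h.hor v b e with h' | h'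
        · exact absurd ((hx' v).1 ⟨e, h'⟩) a
        · exact h'
  have keyc : ∀ v, T.Adj c v ↔ v = x ∨ v = d := by
    intro v
    have := hx' v
    have := h.cd
    by_cases hv : v = d
    · subst hv; tauto
    · tauto
  have hxd := hxx.1
  by_cases u1 : u = c
  · subst u1; rw [keyc]; grind
  by_cases u2 : u = d
  · subst u2; rw [key]; grind
  by_cases v1 : v = c
  · subst v1; rw [T.adj_comm, keyc]; grind
  by_cases v2 : v = d
  · subst v2; rw [T.adj_comm, key]; grind
  have := h.no u v u1 u2 v1 v2
  grind

lemma of_iso (hn : 4 ≤ n) (e : T ≃g Tnd n 3 0) : ∃ c d, DS T c d ∧ (lv T c d).card = 1 := by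
  have ha : ∀ u v, T.Adj u v ↔ (Tnd n 3 0).Adj (e u) (e v) := fun u v => e.map_adj_iff.symm
  simp only [tnd_adj] at ha
  obtain ⟨x, hx⟩ := e.surjective ⟨0, by omega⟩
  obtain ⟨c, hc⟩ := e.surjective ⟨1, by omega⟩
  obtain ⟨d, hd⟩ := e.surjective ⟨2, by omega⟩
  obtain ⟨y, hy⟩ := e.surjective ⟨3, by omega⟩
  rw [Fin.ext_iff] at hx hc hd hy
  simp only at hx hc hd hy
  have inj : ∀ u v, u = v ↔ (e u).val = (e v).val := fun u v => by
    rw [← Fin.ext_iff, e.injective.eq_iff]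
  refine ⟨c, d, ⟨?_, ?_, ?_, ?_, ⟨x, ?_⟩, ⟨y, ?_⟩⟩, ?_⟩
  · rw [ha]; omega
  · intro v; simp only [Ne, inj, ha]; omega
  · intro v; simp only [ha]; omega
  · intro u v; simp only [Ne, inj, ha]; omega
  · simp only [Ne, inj, ha]; omega
  · simp only [Ne, inj, ha]; omega
  · rw [Finset.card_eq_one]
    refine ⟨x, ?_⟩
    ext v
    rw [mem_lv, Finset.mem_singleton]
    simp only [Ne, inj, ha]; omega
end

/-- Corollary 5.2: minimum `𝓔`-energy among complements of trees of diameter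
`3`. -/
theorem stmt_14 {n : ℕ} (T : SimpleGraph (Fin n)) (hT : T.IsTree) (hd : gdiam T = 3) :
    2 * Real.sqrt (4 * (n : ℝ) + 1 + 8 * Real.sqrt ((n : ℝ) - 3)) ≤ eccEnergy Tᶜ ∧
    (eccEnergy Tᶜ = 2 * Real.sqrt (4 * (n : ℝ) + 1 + 8 * Real.sqrt ((n : ℝ) - 3)) ↔
      Nonempty (T ≃g Tnd n 3 0)) := by
  obtain ⟨c, d, h⟩ := exists_DS T hT hd
  have hc := h.card
  have hp := h.one_le
  have hq := h.symm.one_le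
  have key : ∀ m : ℕ, n - 3 ≤ m →
      2 * Real.sqrt (4 * (n : ℝ) + 1 + 8 * Real.sqrt ((n : ℝ) - 3)) ≤
        2 * Real.sqrt (4 * (n : ℝ) + 1 + 8 * Real.sqrt (m : ℝ)) ∧
      (2 * Real.sqrt (4 * (n : ℝ) + 1 + 8 * Real.sqrt (m : ℝ)) =
        2 * Real.sqrt (4 * (n : ℝ) + 1 + 8 * Real.sqrt ((n : ℝ) - 3)) → m = n - 3) := by
    intro m hm
    have h3 : (n : ℝ) - 3 = ((n - 3 : ℕ) : ℝ) := by
      rw [Nat.cast_sub (by omega)]; norm_num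
    rw [h3]
    have hm' : ((n - 3 : ℕ) : ℝ) ≤ m := by exact_mod_cast hm
    refine ⟨by gcongr, ?_⟩
    intro heq
    have h4 := mul_left_cancel₀ two_ne_zero heq
    rw [Real.sqrt_inj (by positivity) (by positivity)] at h4
    have h5 : Real.sqrt (m : ℝ) = Real.sqrt ((n - 3 : ℕ) : ℝ) := by linarith
    rw [Real.sqrt_inj (by positivity) (by positivity)] at h5
    exact_mod_cast h5
  have hpq : n - 3 ≤ (lv T c d).card * (lv T d c).card := by
    obtain ⟨a, ha⟩ := Nat.exists_eq_add_of_le hp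
    obtain ⟨b, hb⟩ := Nat.exists_eq_add_of_le hq
    rw [ha, hb] at hc ⊢
    have : n - 3 = a + b + 1 := by omega
    rw [this]; nlinarith
  obtain ⟨k1, k2⟩ := key _ hpq
  refine ⟨by rw [h.energy]; exact k1, ?_, ?_⟩
  · intro heq
    rw [h.energy] at heq
    have h6 := k2 heq
    have h7 : (lv T c d).card = 1 ∨ (lv T d c).card = 1 := by
      obtain ⟨a, ha⟩ := Nat.exists_eq_add_of_le hp
      obtain ⟨b, hb⟩ := Nat.exists_eq_add_of_le hq
      rw [ha, hb] at hc h6 ⊢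
      have h8 : n - 3 = a + b + 1 := by omega
      rw [h8] at h6
      have h9 : a * b = 0 := by nlinarith
      rcases Nat.mul_eq_zero.1 h9 with h0 | h0 <;> simp [h0]
    rcases h7 with h7 | h7
    · exact iso_of h h7
    · exact iso_of h.symm h7
  · rintro ⟨e⟩
    obtain ⟨c', d', h', h1⟩ := of_iso (by omega) e
    have hc' := h'.card
    have h2 : (n : ℝ) - 3 = ((1 * (lv T d' c').card : ℕ) : ℝ) := by
      have h3 : (n : ℝ) = (lv T c' d').card + (lv T d' c').card + 2 := by exact_mod_cast hc'.symm
      rw [h3, h1]; push_cast; ring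
    rw [h'.energy, h1, h2]
end
end
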